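/- Let p > 0 and α ≤ p. Then A is equivalent to Ã∘a at infinity and Ã is equivalent to A∘ã at infinity: there exist constants c, C > 0 and t₀ ≥ 0 such that c·A(t) ≤ Ã(a(t)) ≤ C·A(t) and c·Ã(t) ≤ A(ã(t)) ≤ C·Ã(t) for all t ≥ t₀. -/

import Mathlib

open Real Set

/-- a(t) = t^p / (log(e+t))^α. -/
noncomputable def a (p α t : ℝ) : ℝ := t ^ p / Real.log (Real.exp 1 + t) ^ α

/-- A(t) = ∫₀ᵗ a(s) ds. -/
noncomputable def A (p α t : ℝ) : ℝ := ∫ s in (0:ℝ)..t, a p α s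

/-- Ã(t) = ∫₀ᵗ ã(s) ds, where ã is a given function (intended as a⁻¹). -/
noncomputable def Atilde (atil : ℝ → ℝ) (t : ℝ) : ℝ := ∫ s in (0:ℝ)..t, atil s

theorem one_le_log_exp_one_add {t : ℝ} (ht : 0 ≤ t) : 1 ≤ Real.log (Real.exp 1 + t) := by
  rw [Real.le_log_iff_exp_le (by positivity)]
  linarith

theorem a_nonneg (p α : ℝ) {t : ℝ} (ht : 0 ≤ t) : 0 ≤ a p α t := by
  have := one_le_log_exp_one_add ht
  unfold a
  positivity

theorem a_zero {p : ℝ} (hp : 0 < p) (α : ℝ) : a p α 0 = 0 := by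
  simp [a, Real.zero_rpow hp.ne']

theorem log_exp_one_add_mul_le {k x : ℝ} (hk : 1 ≤ k) (hx : 0 ≤ x) :
    Real.log (Real.exp 1 + k * x) ≤ (1 + Real.log k) * Real.log (Real.exp 1 + x) := by
  have hL := one_le_log_exp_one_add hx
  have hlk := Real.log_nonneg hk
  have he := Real.exp_pos 1
  calc Real.log (Real.exp 1 + k * x) ≤ Real.log (k * (Real.exp 1 + x)) := by
        apply Real.log_le_log (by positivity)
        nlinarith
    _ = Real.log k + Real.log (Real.exp 1 + x) := Real.log_mul (by positivity) (by positivity)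
    _ ≤ (1 + Real.log k) * Real.log (Real.exp 1 + x) := by nlinarith

theorem a_mul_eq (p α : ℝ) {k x : ℝ} (hk : 1 ≤ k) (hx : 0 ≤ x) :
    a p α x * k ^ p = a p α (k * x) *
      (Real.log (Real.exp 1 + k * x) / Real.log (Real.exp 1 + x)) ^ α := by
  have h1 := one_le_log_exp_one_add hx
  have h2 := one_le_log_exp_one_add (t := k * x) (by positivity)
  have h3 : 0 < Real.log (Real.exp 1 + x) ^ α := by positivity
  have h4 : 0 < Real.log (Real.exp 1 + k * x) ^ α := by positivity
  unfold a
  rw [Real.div_rpow (by positivity) (by positivity), Real.mul_rpow (by positivity) hx]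
  generalize Real.log (Real.exp 1 + k * x) ^ α = M at h4 ⊢
  field_simp

theorem one_le_log_ratio {k x : ℝ} (hk : 1 ≤ k) (hx : 0 ≤ x) :
    1 ≤ Real.log (Real.exp 1 + k * x) / Real.log (Real.exp 1 + x) := by
  have h1 := one_le_log_exp_one_add hx
  rw [one_le_div (by positivity)]
  exact Real.log_le_log (by positivity) (by nlinarith)

theorem log_ratio_le {k x : ℝ} (hk : 1 ≤ k) (hx : 0 ≤ x) :
    Real.log (Real.exp 1 + k * x) / Real.log (Real.exp 1 + x) ≤ 1 + Real.log k := by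
  have h1 := one_le_log_exp_one_add hx
  rw [div_le_iff₀ (by positivity)]
  exact log_exp_one_add_mul_le hk hx

theorem a_le_mul_a_mul {p α : ℝ} (hp : 0 < p) (hα : α ≤ p) {k x : ℝ} (hk : 1 ≤ k) (hx : 0 ≤ x) :
    a p α x ≤ ((1 + Real.log k) / k) ^ p * a p α (k * x) := by
  have hlk := Real.log_nonneg hk
  have h0 := one_le_log_ratio hk hx
  have h1 := log_ratio_le hk hx
  have hr := (Real.rpow_le_rpow_of_exponent_le h0 hα).trans
    (Real.rpow_le_rpow (by positivity) h1 hp.le)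
  have hkp : 0 < k ^ p := by positivity
  have ha := a_nonneg p α (t := k * x) (by positivity)
  rw [Real.div_rpow (by positivity) (by positivity), div_mul_eq_mul_div, le_div_iff₀ hkp,
    a_mul_eq p α hk hx, mul_comm]
  gcongr

theorem a_monotoneOn {p α : ℝ} (hp : 0 < p) (hα : α ≤ p) : MonotoneOn (a p α) (Ici 0) := by
  intro x hx y hy hxy
  rcases (mem_Ici.1 hx).eq_or_lt with rfl | hx0
  · rw [a_zero hp]
    exact a_nonneg p α hy
  have hk : 1 ≤ y / x := (one_le_div hx0).2 hxy
  have h := a_le_mul_a_mul hp hα hk hx0.le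
  rw [div_mul_cancel₀ _ hx0.ne'] at h
  refine h.trans (mul_le_of_le_one_left (a_nonneg p α hy) ?_)
  have hlk := Real.log_nonneg hk
  apply Real.rpow_le_one (by positivity) _ hp.le
  rw [div_le_one (by positivity)]
  linarith [Real.log_le_sub_one_of_pos (zero_lt_one.trans_le hk)]

theorem mul_a_two_mul_le (p α : ℝ) {x : ℝ} (hx : 0 ≤ x) :
    (2 : ℝ) ^ (-|α| - p) * a p α (2 * x) ≤ a p α x := by
  have h0 := one_le_log_ratio one_le_two hx
  have h1 : Real.log (Real.exp 1 + 2 * x) / Real.log (Real.exp 1 + x) ≤ 2 :=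
    (log_ratio_le one_le_two hx).trans (by linarith [Real.log_two_lt_d9])
  have hr : (2 : ℝ) ^ (-|α|) ≤
      (Real.log (Real.exp 1 + 2 * x) / Real.log (Real.exp 1 + x)) ^ α :=
    (Real.rpow_le_rpow_of_nonpos (by positivity) h1 (by simp)).trans
      (Real.rpow_le_rpow_of_exponent_le h0 (neg_abs_le α))
  have ha := a_nonneg p α (t := 2 * x) (by positivity)
  rw [Real.rpow_sub two_pos, div_mul_eq_mul_div, div_le_iff₀ (by positivity),
    a_mul_eq p α one_le_two hx, mul_comm]
  gcongr

theorem MonotoneOn.intervalIntegrable_of_Ici {f : ℝ → ℝ} (hf : MonotoneOn f (Ici 0)) {u t : ℝ}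
    (hu : 0 ≤ u) (hut : u ≤ t) : IntervalIntegrable f MeasureTheory.volume u t :=
  MonotoneOn.intervalIntegrable <| hf.mono fun x hx => by
    rw [uIcc_of_le hut] at hx
    exact hu.trans hx.1

theorem MonotoneOn.integral_le_mul {f : ℝ → ℝ} (hf : MonotoneOn f (Ici 0)) {t : ℝ}
    (ht : 0 ≤ t) : ∫ s in (0 : ℝ)..t, f s ≤ t * f t := by
  have h := intervalIntegral.integral_mono_on ht (hf.intervalIntegrable_of_Ici le_rfl ht)
    intervalIntegrable_const (fun x hx => hf hx.1 ht hx.2)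
  simpa using h

theorem MonotoneOn.mul_le_integral {f : ℝ → ℝ} (hf : MonotoneOn f (Ici 0))
    (hf0 : ∀ x, 0 ≤ x → 0 ≤ f x) {u t : ℝ} (hu : 0 ≤ u) (hut : u ≤ t) :
    (t - u) * f u ≤ ∫ s in (0 : ℝ)..t, f s := by
  have hi := hf.intervalIntegrable_of_Ici hu hut
  rw [← intervalIntegral.integral_add_adjacent_intervals
    (hf.intervalIntegrable_of_Ici le_rfl hu) hi]
  have h := intervalIntegral.integral_mono_on hut intervalIntegrable_const hi
    (fun x hx => hf hu (hu.trans hx.1) hx.1)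
  have h0 : 0 ≤ ∫ s in (0 : ℝ)..u, f s :=
    intervalIntegral.integral_nonneg hu fun x hx => hf0 x hx.1
  rw [intervalIntegral.integral_const, smul_eq_mul] at h
  linarith

theorem MonotoneOn.of_invOn_Ici {f g : ℝ → ℝ} (hf : MonotoneOn f (Ici 0))
    (hg : MapsTo g (Ici 0) (Ici 0)) (hinv : RightInvOn g f (Ici 0)) :
    MonotoneOn g (Ici 0) := by
  intro x hx y hy hxy
  by_contra! hlt
  have h := hf (hg hy) (hg hx) hlt.le
  rw [hinv hx, hinv hy] at h
  rw [le_antisymm hxy h] at hlt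
  exact hlt.false

theorem A_bounds {p α : ℝ} (hp : 0 < p) (hα : α ≤ p) {t : ℝ} (ht : 0 ≤ t) :
    (2 : ℝ) ^ (-|α| - p) / 2 * (t * a p α t) ≤ A p α t ∧ A p α t ≤ t * a p α t := by
  have hm := a_monotoneOn hp hα
  refine ⟨?_, hm.integral_le_mul ht⟩
  have h1 := hm.mul_le_integral (fun x => a_nonneg p α) (u := t / 2) (t := t)
    (by positivity) (by linarith)
  have h2 := mul_a_two_mul_le p α (x := t / 2) (by positivity)
  rw [mul_div_cancel₀ t two_ne_zero] at h2
  unfold A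
  nlinarith [mul_le_mul_of_nonneg_left h2 ht]

theorem Atilde_bounds {p α : ℝ} (hp : 0 < p) (hα : α ≤ p) {atil : ℝ → ℝ}
    (hmaps : MapsTo atil (Ici 0) (Ici 0)) (hinv : InvOn atil (a p α) (Ici 0) (Ici 0))
    {t : ℝ} (ht : 0 ≤ t) :
    (1 - ((1 + Real.log 2) / 2) ^ p) / 2 * (t * a p α t) ≤ Atilde atil (a p α t) ∧
      Atilde atil (a p α t) ≤ t * a p α t := by
  have hm := (a_monotoneOn hp hα).of_invOn_Ici hmaps hinv.2
  have ha := a_nonneg p α ht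
  have ht2 : 0 ≤ t / 2 := by positivity
  have hh := a_nonneg p α ht2
  constructor
  · have h1 := hm.mul_le_integral (fun x hx => hmaps hx) hh
      (a_monotoneOn hp hα ht2 ht (by linarith))
    rw [hinv.1 ht2] at h1
    have h2 := a_le_mul_a_mul hp hα one_le_two ht2
    rw [mul_div_cancel₀ t two_ne_zero] at h2
    unfold Atilde
    nlinarith [mul_le_mul_of_nonneg_left h2 ht]
  · have h := hm.integral_le_mul ha
    rw [hinv.1 ht, mul_comm] at h
    exact h

/-- For p > 0 and α ≤ p, A is equivalent to Ã∘a at infinity and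
Ã is equivalent to A∘ã at infinity: there exist c, C > 0 and t₀ ≥ 0 such that
c·A(t) ≤ Ã(a(t)) ≤ C·A(t) and c·Ã(t) ≤ A(ã(t)) ≤ C·Ã(t) for all t ≥ t₀. -/
theorem A_Atilde_equivalence_at_infinity (p α : ℝ) (hp : 0 < p) (hα : α ≤ p)
    (atil : ℝ → ℝ) (hmaps : Set.MapsTo atil (Set.Ici 0) (Set.Ici 0))
    (hinv : Set.InvOn atil (a p α) (Set.Ici 0) (Set.Ici 0)) :
    ∃ c C t₀ : ℝ, 0 < c ∧ 0 < C ∧ 0 ≤ t₀ ∧ ∀ t : ℝ, t₀ ≤ t →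
      (c * A p α t ≤ Atilde atil (a p α t) ∧ Atilde atil (a p α t) ≤ C * A p α t) ∧
      (c * Atilde atil t ≤ A p α (atil t) ∧ A p α (atil t) ≤ C * Atilde atil t) := by
  obtain ⟨c, hc, hcA, hcB⟩ : ∃ c : ℝ, 0 < c ∧ c ≤ (2 : ℝ) ^ (-|α| - p) / 2 ∧
      c ≤ (1 - ((1 + Real.log 2) / 2) ^ p) / 2 := by
    have hl := Real.log_nonneg one_le_two
    have hlt : ((1 + Real.log 2) / 2) ^ p < 1 :=
      Real.rpow_lt_one (by positivity) (by linarith [Real.log_two_lt_d9]) hp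
    exact ⟨min _ _, lt_min (by positivity) (by linarith), min_le_left _ _, min_le_right _ _⟩
  have key : ∀ x : ℝ, 0 ≤ x →
      (c * A p α x ≤ Atilde atil (a p α x) ∧ Atilde atil (a p α x) ≤ c⁻¹ * A p α x) ∧
      (c * Atilde atil (a p α x) ≤ A p α x ∧ A p α x ≤ c⁻¹ * Atilde atil (a p α x)) := by
    intro x hx
    obtain ⟨hA, hA'⟩ := A_bounds hp hα hx
    obtain ⟨hB, hB'⟩ := Atilde_bounds hp hα hmaps hinv hx
    have hxa : 0 ≤ x * a p α x := mul_nonneg hx (a_nonneg p α hx)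
    have h1 := (mul_le_mul_of_nonneg_right hcA hxa).trans hA
    have h2 := (mul_le_mul_of_nonneg_right hcB hxa).trans hB
    have h3 := (mul_le_mul_of_nonneg_left hA' hc.le).trans h2
    have h4 := (mul_le_mul_of_nonneg_left hB' hc.le).trans h1
    exact ⟨⟨h3, (le_inv_mul_iff₀ hc).2 h4⟩, h4, (le_inv_mul_iff₀ hc).2 h3⟩
  refine ⟨c, c⁻¹, 0, hc, inv_pos.2 hc, le_rfl, fun t ht => ⟨(key t ht).1, ?_⟩⟩
  have h := (key (atil t) (hmaps ht)).2
  rwa [hinv.2 ht] at h
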